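/- arXiv:2310.04102 — 2 statements merged into one kernel-verified Lean document; each statement's English description precedes it below -/
import Mathlib

section
/- For any agent location profile x ∈ [0,1]^n (n ≥ 1), the Nash welfare is single-peaked as a function of the facility location: there exists a unique y* ∈ [0,1] such that y ↦ Nash(y, x) is strictly increasing on [0, y*] and strictly decreasing on [y*, 1]. In particular, y* is the unique Nash optimum for x. -/
open Set

noncomputable section

/-- Utility of an agent at location `z` when the facility is at `y`. -/
def util (y z : ℝ) : ℝ := 1 - |y - z|

/-- Nash welfare: product of agents' utilities. -/
def nash {n : ℕ} (y : ℝ) (x : Fin n → ℝ) : ℝ := ∏ i, util y (x i)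

/-- `y` is a Nash optimum for the profile `x`. -/
def isNashOpt {n : ℕ} (x : Fin n → ℝ) (y : ℝ) : Prop :=
  y ∈ Set.Icc (0 : ℝ) 1 ∧ ∀ z ∈ Set.Icc (0 : ℝ) 1, nash z x ≤ nash y x

lemma util_nonneg {y z : ℝ} (hy : y ∈ Icc (0 : ℝ) 1) (hz : z ∈ Icc (0 : ℝ) 1) :
    0 ≤ util y z := by
  have : |y - z| ≤ 1 := abs_le.2 ⟨by linarith [hy.1, hz.2], by linarith [hy.2, hz.1]⟩
  unfold util
  linarith

lemma util_pos {y z : ℝ} (hy : y ∈ Ioo (0 : ℝ) 1) (hz : z ∈ Icc (0 : ℝ) 1) :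
    0 < util y z := by
  have : |y - z| < 1 := abs_lt.2 ⟨by linarith [hy.1, hz.2], by linarith [hy.2, hz.1]⟩
  unfold util
  linarith

/-- Utility is strictly log-concave in the facility location where it is positive. -/
lemma log_util_lt {a b t s z : ℝ} (hab : a < b) (ht : 0 < t) (hs : 0 < s) (hts : t + s = 1)
    (ha : 0 < util a z) (hb : 0 < util b z) :
    t * Real.log (util a z) + s * Real.log (util b z) < Real.log (util (t * a + s * b) z) := by
  have hconc : t * util a z + s * util b z ≤ util (t * a + s * b) z := by
    have h : t * a + s * b - z = t * (a - z) + s * (b - z) := by linear_combination z * hts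
    have h' := abs_add_le (t * (a - z)) (s * (b - z))
    rw [abs_mul, abs_mul, abs_of_pos ht, abs_of_pos hs] at h'
    unfold util
    rw [h]
    linarith
  have hmean : 0 < t * util a z + s * util b z := by positivity
  rcases eq_or_ne (util a z) (util b z) with heq | hne
  · rw [← heq, ← add_mul, hts, one_mul]
    refine Real.log_lt_log ha ?_
    have habs : |a - z| = |b - z| := by
      unfold util at heq
      linarith
    have hz : a - z = -(b - z) := by
      rcases abs_eq_abs.1 habs with h | h
      · linarith
      · exact h
    have hbz : |b - z| = b - z := abs_of_pos (by linarith)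
    unfold util
    rw [habs, hbz]
    have : |t * a + s * b - z| < b - z := by
      have := mul_pos ht (sub_pos.2 hab)
      have := mul_pos hs (sub_pos.2 hab)
      have h₁ : t * a + s * b = b - t * (b - a) := by linear_combination b * hts
      have h₂ : t * a + s * b = a + s * (b - a) := by linear_combination a * hts
      exact abs_lt.2 ⟨by linarith, by linarith⟩
    linarith
  · have h := strictConcaveOn_log_Ioi.2 (mem_Ioi.2 ha) (mem_Ioi.2 hb) hne ht hs hts
    simp only [smul_eq_mul] at h
    exact h.trans_le (Real.log_le_log hmean hconc)

lemma nash_nonneg {n : ℕ} {x : Fin n → ℝ} (hx : ∀ i, x i ∈ Icc (0 : ℝ) 1) {y : ℝ}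
    (hy : y ∈ Icc (0 : ℝ) 1) : 0 ≤ nash y x :=
  Finset.prod_nonneg fun i _ => util_nonneg hy (hx i)

lemma continuous_nash {n : ℕ} (x : Fin n → ℝ) : Continuous fun y => nash y x := by
  unfold nash util
  fun_prop

/-- Nash welfare is strictly quasiconcave in the facility location. -/
lemma min_nash_lt {n : ℕ} (hn : 1 ≤ n) {x : Fin n → ℝ} (hx : ∀ i, x i ∈ Icc (0 : ℝ) 1)
    {a b c : ℝ} (ha : 0 ≤ a) (hac : a < c) (hcb : c < b) (hb : b ≤ 1) :
    min (nash a x) (nash b x) < nash c x := by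
  have ha' : a ∈ Icc (0 : ℝ) 1 := ⟨ha, by linarith⟩
  have hb' : b ∈ Icc (0 : ℝ) 1 := ⟨by linarith, hb⟩
  have hc (i : Fin n) : 0 < util c (x i) := util_pos ⟨by linarith, by linarith⟩ (hx i)
  have hcpos : 0 < nash c x := Finset.prod_pos fun i _ => hc i
  rcases (nash_nonneg hx ha').eq_or_lt with hA | hA
  · exact (min_le_left _ _).trans_lt (hA ▸ hcpos)
  rcases (nash_nonneg hx hb').eq_or_lt with hB | hB
  · exact (min_le_right _ _).trans_lt (hB ▸ hcpos)
  have hua (i : Fin n) : util a (x i) ≠ 0 := Finset.prod_ne_zero_iff.1 hA.ne' i (Finset.mem_univ i)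
  have hub (i : Fin n) : util b (x i) ≠ 0 := Finset.prod_ne_zero_iff.1 hB.ne' i (Finset.mem_univ i)
  obtain ⟨t, s, ht, hs, hts, hcomb⟩ : ∃ t s : ℝ, 0 < t ∧ 0 < s ∧ t + s = 1 ∧ t * a + s * b = c := by
    have hba : b - a ≠ 0 := by linarith
    refine ⟨(b - c) / (b - a), (c - a) / (b - a), div_pos (by linarith) (by linarith),
      div_pos (by linarith) (by linarith), ?_, ?_⟩
    · field_simp
      ring
    · field_simp
      ring
  have hlog : t * Real.log (nash a x) + s * Real.log (nash b x) < Real.log (nash c x) := by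
    unfold nash
    rw [Real.log_prod fun i _ => hua i, Real.log_prod fun i _ => hub i,
      Real.log_prod fun i _ => (hc i).ne', Finset.mul_sum, Finset.mul_sum,
      ← Finset.sum_add_distrib]
    refine Finset.sum_lt_sum_of_nonempty ⟨⟨0, hn⟩, Finset.mem_univ _⟩ fun i _ => ?_
    rw [← hcomb]
    exact log_util_lt (hac.trans hcb) ht hs hts ((util_nonneg ha' (hx i)).lt_of_ne' (hua i))
      ((util_nonneg hb' (hx i)).lt_of_ne' (hub i))
  by_contra! hle
  have h₁ := Real.log_le_log hcpos (hle.trans (min_le_left _ _))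
  have h₂ := Real.log_le_log hcpos (hle.trans (min_le_right _ _))
  have h₃ : t * Real.log (nash c x) + s * Real.log (nash c x) = Real.log (nash c x) := by
    rw [← add_mul, hts, one_mul]
  linarith [mul_le_mul_of_nonneg_left h₁ ht.le, mul_le_mul_of_nonneg_left h₂ hs.le]

theorem nash_single_peaked (n : ℕ) (hn : 1 ≤ n) (x : Fin n → ℝ)
    (hx : ∀ i, x i ∈ Set.Icc (0 : ℝ) 1) :
    ∃ ystar ∈ Set.Icc (0 : ℝ) 1,
      StrictMonoOn (fun y => nash y x) (Set.Icc 0 ystar) ∧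
      StrictAntiOn (fun y => nash y x) (Set.Icc ystar 1) ∧
      (∀ y' ∈ Set.Icc (0 : ℝ) 1,
        StrictMonoOn (fun y => nash y x) (Set.Icc 0 y') →
        StrictAntiOn (fun y => nash y x) (Set.Icc y' 1) → y' = ystar) ∧
      (∀ z, isNashOpt x z ↔ z = ystar) := by
  obtain ⟨p, hp, hmax⟩ := isCompact_Icc.exists_isMaxOn (nonempty_Icc.2 zero_le_one)
    (continuous_nash x).continuousOn
  have hle (z : ℝ) (hz : z ∈ Icc (0 : ℝ) 1) : nash z x ≤ nash p x := hmax hz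
  have hlt (z : ℝ) (hz : z ∈ Icc (0 : ℝ) 1) (hzp : z ≠ p) : nash z x < nash p x := by
    rcases hzp.lt_or_gt with h | h
    · obtain ⟨c, h₁, h₂⟩ := exists_between h
      have hmin := min_nash_lt hn hx hz.1 h₁ h₂ hp.2
      rw [min_eq_left (hle z hz)] at hmin
      exact hmin.trans_le (hle c ⟨by linarith [hz.1], by linarith [hp.2]⟩)
    · obtain ⟨c, h₁, h₂⟩ := exists_between h
      have hmin := min_nash_lt hn hx hp.1 h₁ h₂ hz.2
      rw [min_eq_right (hle z hz)] at hmin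
      exact hmin.trans_le (hle c ⟨by linarith [hp.1], by linarith [hz.2]⟩)
  refine ⟨p, hp, ?_, ?_, ?_, ?_⟩
  · intro a ha b hb hab
    have ha' : a ∈ Icc (0 : ℝ) 1 := ⟨ha.1, ha.2.trans hp.2⟩
    rcases hb.2.eq_or_lt with rfl | hbp
    · exact hlt a ha' hab.ne
    · have hmin := min_nash_lt hn hx ha.1 hab hbp hp.2
      rwa [min_eq_left (hle a ha')] at hmin
  · intro a ha b hb hab
    have hb' : b ∈ Icc (0 : ℝ) 1 := ⟨hp.1.trans hb.1, hb.2⟩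
    rcases ha.1.eq_or_lt with rfl | hpa
    · exact hlt b hb' hab.ne'
    · have hmin := min_nash_lt hn hx hp.1 hpa hab hb.2
      rwa [min_eq_right (hle b hb')] at hmin
  · intro y hy hmono hanti
    rcases lt_trichotomy y p with h | h | h
    · exact absurd (hanti ⟨le_rfl, hy.2⟩ ⟨h.le, hp.2⟩ h) (hle y hy).not_gt
    · exact h
    · exact absurd (hmono ⟨hp.1, h.le⟩ ⟨hy.1, le_rfl⟩ h) (hle y hy).not_gt
  · refine fun z => ⟨fun hz => ?_, ?_⟩
    · by_contra hne
      exact (hz.2 p hp).not_gt (hlt z hz.1 hne)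
    · rintro rfl
      exact ⟨hp, hle⟩
end
end

section
/- For n ≥ 2 and 1 ≤ k ≤ n − k, consider the profile x with n − k agents at 0 and k agents at 1. Then: (i) the maximum of USW(y, x) over y ∈ [0,1] equals n − k (attained at y = 0); (ii) y* = k/n is a Nash optimum for x, and USW(k/n, x) = (k² + (n − k)²)/n; so the ratio of optimal utilitarian welfare to the utilitarian welfare at the Nash optimum equals n(n − k)/(k² + (n − k)²). Consequently, for every ε > 0 there exist n, k and such a profile for which this ratio exceeds (√2 + 1)/2 − ε. -/
open Set

noncomputable section

/-- Utilitarian social welfare: sum of agents' utilities. -/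
def usw {n : ℕ} (y : ℝ) (x : Fin n → ℝ) : ℝ := ∑ i, util y (x i)

theorem util_zero_right {y : ℝ} (hy : 0 ≤ y) : util y 0 = 1 - y := by
  simp [util, abs_of_nonneg hy]

theorem util_one_right {y : ℝ} (hy : y ≤ 1) : util y 1 = y := by
  rw [util, abs_of_nonpos (by linarith)]
  ring

/-- Utilitarian welfare when `m` agents are at `0` and `k` agents are at `1`. -/
theorem usw_two_point {m k : ℕ} {x : Fin (m + k) → ℝ}
    (hx : ∀ i, x i = if (i : ℕ) < m then 0 else 1) {y : ℝ} (hy : y ∈ Set.Icc (0 : ℝ) 1) :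
    usw y x = m * (1 - y) + k * y := by
  simp [usw, hx, Fin.sum_univ_add, util_zero_right hy.1, util_one_right hy.2, mul_sub]

/-- Nash welfare when `m` agents are at `0` and `k` agents are at `1`. -/
theorem nash_two_point {m k : ℕ} {x : Fin (m + k) → ℝ}
    (hx : ∀ i, x i = if (i : ℕ) < m then 0 else 1) {y : ℝ} (hy : y ∈ Set.Icc (0 : ℝ) 1) :
    nash y x = (1 - y) ^ m * y ^ k := by
  simp [nash, hx, Fin.prod_univ_add, util_zero_right hy.1, util_one_right hy.2]

/-- Weighted AM-GM with natural weights, normalised so that the weighted mean is `1`. -/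
theorem pow_mul_pow_le_one {m k : ℕ} {a b : ℝ} (ha : 0 ≤ a) (hb : 0 ≤ b)
    (hab : m * a + k * b = m + k) : a ^ m * b ^ k ≤ 1 := by
  have hle (t : ℝ) : t ≤ Real.exp (t - 1) := by linarith [Real.add_one_le_exp (t - 1)]
  calc a ^ m * b ^ k ≤ Real.exp (a - 1) ^ m * Real.exp (b - 1) ^ k := by
        gcongr
        · exact hle a
        · exact hle b
    _ = 1 := by
        rw [← Real.exp_nat_mul, ← Real.exp_nat_mul, ← Real.exp_add, Real.exp_eq_one_iff]
        linarith

theorem one_sub_pow_mul_pow_le {m k : ℕ} (hm : 0 < m) (hk : 0 < k) {z : ℝ}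
    (hz : z ∈ Set.Icc (0 : ℝ) 1) :
    (1 - z) ^ m * z ^ k ≤ (1 - (k : ℝ) / (m + k)) ^ m * ((k : ℝ) / (m + k)) ^ k := by
  have hm' : (0 : ℝ) < m := by exact_mod_cast hm
  have hk' : (0 : ℝ) < k := by exact_mod_cast hk
  have hcompl : 1 - (k : ℝ) / (m + k) = m / (m + k) := by field_simp; ring
  rw [hcompl]
  set p : ℝ := m / (m + k) with hp
  set q : ℝ := k / (m + k) with hq
  have hp0 : 0 < p := by positivity
  have hq0 : 0 < q := by positivity
  have h1z : 0 ≤ 1 - z := by linarith [hz.2]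
  have h : ((1 - z) / p) ^ m * (z / q) ^ k ≤ 1 := by
    refine pow_mul_pow_le_one (by positivity) (div_nonneg hz.1 hq0.le) ?_
    rw [hp, hq]
    field_simp
    ring
  rwa [div_pow (1 - z), div_pow z, div_mul_div_comm, div_le_one (by positivity)] at h

theorem isNashOpt_two_point {m k : ℕ} (hm : 0 < m) (hk : 0 < k) {x : Fin (m + k) → ℝ}
    (hx : ∀ i, x i = if (i : ℕ) < m then 0 else 1) :
    isNashOpt x ((k : ℝ) / (m + k)) := by
  have hmem : (k : ℝ) / (m + k) ∈ Set.Icc (0 : ℝ) 1 :=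
    ⟨by positivity, div_le_one_of_le₀ (by simp) (by positivity)⟩
  refine ⟨hmem, fun z hz => ?_⟩
  rw [nash_two_point hx hz, nash_two_point hx hmem]
  exact one_sub_pow_mul_pow_le hm hk hz

theorem ratio_at_optimum :
    (1 - (1 - Real.sqrt 2 / 2)) / ((1 - Real.sqrt 2 / 2) ^ 2 + (1 - (1 - Real.sqrt 2 / 2)) ^ 2) =
      (Real.sqrt 2 + 1) / 2 := by
  have h2 : Real.sqrt 2 ^ 2 = 2 := Real.sq_sqrt (by norm_num)
  rw [div_eq_iff (by nlinarith [sq_nonneg (1 - Real.sqrt 2 / 2)])]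
  ring_nf
  have h3 : Real.sqrt 2 ^ 3 = 2 * Real.sqrt 2 := by rw [pow_succ, h2]
  rw [h3, h2]
  ring

/-- A rational fraction `q < 1/2` of agents at `1` makes the welfare ratio nearly `(√2 + 1) / 2`. -/
theorem exists_rat_ratio_gt {ε : ℝ} (hε : 0 < ε) : ∃ q : ℚ, 0 < q ∧ q < 1 / 2 ∧
    (Real.sqrt 2 + 1) / 2 - ε < (1 - (q : ℝ)) / ((q : ℝ) ^ 2 + (1 - (q : ℝ)) ^ 2) := by
  have hcont : Continuous fun t : ℝ => (1 - t) / (t ^ 2 + (1 - t) ^ 2) := by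
    refine Continuous.div (by fun_prop) (by fun_prop) fun t => ?_
    nlinarith [sq_nonneg (2 * t - 1)]
  have hopen : IsOpen (Set.Ioo (0 : ℝ) (1 / 2) ∩
      {t | (Real.sqrt 2 + 1) / 2 - ε < (1 - t) / (t ^ 2 + (1 - t) ^ 2)}) :=
    isOpen_Ioo.inter (isOpen_lt continuous_const hcont)
  have hlt : Real.sqrt 2 < 2 := by rw [Real.sqrt_lt' (by norm_num)]; norm_num
  have hgt : 1 < Real.sqrt 2 := by rw [Real.lt_sqrt (by norm_num)]; norm_num
  obtain ⟨q, ⟨hq0, hq1⟩, hq⟩ := Rat.denseRange_cast.exists_mem_open hopen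
    ⟨1 - Real.sqrt 2 / 2, ⟨by linarith, by linarith⟩, by
      rw [Set.mem_ofPred_eq, ratio_at_optimum]; linarith⟩
  refine ⟨q, by exact_mod_cast hq0, ?_, hq⟩
  have : (q : ℝ) < ((1 / 2 : ℚ) : ℝ) := by push_cast; exact hq1
  exact_mod_cast this

theorem nashFL_utilitarian_lower :
    (∀ n k : ℕ, 2 ≤ n → 1 ≤ k → k ≤ n - k →
      ∀ x : Fin n → ℝ, (∀ i, x i = if (i : ℕ) < n - k then 0 else 1) →
        ((∀ y ∈ Set.Icc (0 : ℝ) 1, usw y x ≤ (n : ℝ) - k) ∧ usw 0 x = (n : ℝ) - k) ∧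
        isNashOpt x ((k : ℝ) / n) ∧
        usw ((k : ℝ) / n) x = ((k : ℝ) ^ 2 + ((n : ℝ) - k) ^ 2) / n) ∧
    (∀ ε : ℝ, 0 < ε → ∃ n k : ℕ, 1 ≤ k ∧ k ≤ n - k ∧
      ((n : ℝ) * ((n : ℝ) - k)) / ((k : ℝ) ^ 2 + ((n : ℝ) - k) ^ 2) >
        (Real.sqrt 2 + 1) / 2 - ε) := by
  refine ⟨fun n k _ hk hkn x hx => ?_, fun ε hε => ?_⟩
  · obtain ⟨m, rfl⟩ : ∃ m, n = m + k := ⟨n - k, by omega⟩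
    simp only [Nat.add_sub_cancel] at hkn hx
    have hm : 0 < m := by omega
    have hkm : (k : ℝ) ≤ m := by exact_mod_cast hkn
    have hopt := isNashOpt_two_point hm hk hx
    push_cast
    refine ⟨⟨fun y hy => ?_, ?_⟩, hopt, ?_⟩
    · rw [usw_two_point hx hy]
      nlinarith [hy.1]
    · rw [usw_two_point hx (by simp)]
      ring
    · rw [usw_two_point hx hopt.1]
      have hpos : (0 : ℝ) < m + k := by positivity
      field_simp
      ring
  · obtain ⟨q, hq0, hq1, hq⟩ := exists_rat_ratio_gt hε
    obtain ⟨k, hk⟩ := Int.eq_ofNat_of_zero_le (Rat.num_nonneg.2 hq0.le)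
    have hden : (0 : ℚ) < q.den := by exact_mod_cast q.den_pos
    have hqk : q = (k : ℚ) / q.den := by
      conv_lhs => rw [← Rat.num_div_den q, hk]
      simp
    have hk0 : 0 < k := by
      have := Rat.num_pos.2 hq0
      omega
    have hkd : 2 * k < q.den := by
      rw [hqk, div_lt_div_iff₀ hden (by norm_num)] at hq1
      have : (2 * k : ℚ) < q.den := by linarith
      exact_mod_cast this
    refine ⟨q.den, k, hk0, by omega, ?_⟩
    have hqk' : (q : ℝ) = (k : ℝ) / q.den := 
      (congrArg (fun r : ℚ => (r : ℝ)) hqk).trans (by push_cast; rfl)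
    have hden' : (0 : ℝ) < q.den := by exact_mod_cast q.den_pos
    have hkpos : (0 : ℝ) < k := by exact_mod_cast hk0
    rw [gt_iff_lt]
    convert hq using 1
    rw [hqk']
    generalize (q.den : ℝ) = d at hden' ⊢
    field_simp
end
end
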